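/- arXiv:1910.11199 — 5 statements merged into one kernel-verified Lean document; each statement's English description precedes it below -/
import Mathlib

section
/- Let f be Lipschitz continuous of rank L on an open neighborhood of the closed ball B̄_ε(x), where x ∈ X and ε > 0. Then f⁰_ε(x;·) is the support function of ∂^ε f(x): for every h ∈ X the supremum of ⟨a,h⟩ over a ∈ ∂^ε f(x) is attained and f⁰_ε(x;h) = max_{a ∈ ∂^ε f(x)} ⟨a,h⟩. -/
open Filter Metric Set Topology MeasureTheory
open scoped RealInnerProductSpace NNReal

variable {X : Type*} [NormedAddCommGroup X] [InnerProductSpace ℝ X] [CompleteSpace X]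

/-- Clarke's generalized directional derivative. -/
noncomputable def clarkeDeriv (f : X → ℝ) (x h : X) : ℝ :=
  Filter.limsup (fun p : X × ℝ => (f (p.1 + p.2 • h) - f p.1) / p.2)
    ((𝓝 x) ×ˢ (𝓝[>] (0:ℝ)))

/-- Clarke's generalized gradient. -/
noncomputable def clarkeGrad (f : X → ℝ) (x : X) : Set X :=
  {a | ∀ h : X, ⟪a, h⟫ ≤ clarkeDeriv f x h}

/-- The gradient of `f` on the closed ball of radius `ε` about `x`. -/
noncomputable def epsGrad (f : X → ℝ) (ε : ℝ) (x : X) : Set X :=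
  closure (convexHull ℝ (⋃ y ∈ Metric.closedBall x ε, clarkeGrad f y))

/-- The directional derivative of `f` on the closed ball of radius `ε` about `x`. -/
noncomputable def epsDeriv (f : X → ℝ) (ε : ℝ) (x h : X) : ℝ :=
  sSup ((fun y => clarkeDeriv f y h) '' Metric.closedBall x ε)

/-- A sublinear function dominated by a multiple of the norm has, at every point, an exact
linear minorant represented by the inner product. -/
theorem exists_inner_le_sublinear (N : X → ℝ) (C : ℝ)
    (N_smul : ∀ c : ℝ, 0 < c → ∀ v, N (c • v) ≤ c * N v)
    (N_add : ∀ v w, N (v + w) ≤ N v + N w) (N_le : ∀ v, N v ≤ C * ‖v‖) (h : X) :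
    ∃ a : X, (∀ v, ⟪a, v⟫ ≤ N v) ∧ ⟪a, h⟫ = N h := by
  have N_hom : ∀ c : ℝ, 0 < c → ∀ v, N (c • v) = c * N v := by
    intro c hc v
    refine le_antisymm (N_smul c hc v) ?_
    have h1 := N_smul c⁻¹ (inv_pos.2 hc) (c • v)
    rw [smul_smul, inv_mul_cancel₀ hc.ne', one_smul] at h1
    calc c * N v ≤ c * (c⁻¹ * N (c • v)) := by gcongr
      _ = N (c • v) := by rw [← mul_assoc, mul_inv_cancel₀ hc.ne', one_mul]
  have N_zero : N 0 = 0 := by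
    have h2 := N_hom 2 two_pos 0
    rw [smul_zero] at h2
    linarith
  have H : ∀ c : ℝ, c • h = 0 → (RingHom.id ℝ) c • N h = 0 := by
    intro c hc
    rcases smul_eq_zero.1 hc with rfl | rfl
    · simp
    · simp [N_zero]
  obtain ⟨g, hg, hgN⟩ := exists_extension_of_le_sublinear
    (LinearPMap.mkSpanSingleton' h (N h) H) N N_hom N_add (by
      rintro ⟨v, hv⟩
      obtain ⟨c, rfl⟩ := Submodule.mem_span_singleton.1 hv
      rw [LinearPMap.mkSpanSingleton'_apply, smul_eq_mul]
      change c * N h ≤ N (c • h)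
      rcases lt_trichotomy c 0 with hc | rfl | hc
      · have h1 := N_hom (-c) (neg_pos.2 hc) h
        have h2 := N_add (c • h) ((-c) • h)
        rw [← add_smul, add_neg_cancel, zero_smul, N_zero] at h2
        linarith
      · simp [N_zero]
      · exact (N_hom c hc h).ge)
  have hgC : ∀ v, ‖g v‖ ≤ C * ‖v‖ := by
    intro v
    rw [Real.norm_eq_abs, abs_le]
    have h1 := (hgN (-v)).trans (N_le (-v))
    rw [map_neg, norm_neg] at h1
    exact ⟨by linarith, (hgN v).trans (N_le v)⟩
  have hgh : g h = N h := by
    have hmem : h ∈ (LinearPMap.mkSpanSingleton' h (N h) H).domain :=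
      Submodule.mem_span_singleton_self h
    rw [hg ⟨h, hmem⟩]
    exact LinearPMap.mkSpanSingleton'_apply_self h (N h) H hmem
  refine ⟨(InnerProductSpace.toDual ℝ X).symm (g.mkContinuous C hgC), fun v => ?_, ?_⟩
  · rw [InnerProductSpace.toDual_symm_apply]
    exact hgN v
  · rw [InnerProductSpace.toDual_symm_apply]
    exact hgh

section ClarkeDeriv

variable {E : Type*} [NormedAddCommGroup E] [InnerProductSpace ℝ E]
  {f : E → ℝ} {L : ℝ≥0} {U : Set E} {y : E}

theorem tendsto_add_smul_nhds_prod (y k : E) :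
    Tendsto (fun p : E × ℝ => p.1 + p.2 • k) (𝓝 y ×ˢ 𝓝[>] (0 : ℝ)) (𝓝 y) := by
  have h1 : Tendsto (fun p : E × ℝ => p.1 + p.2 • k) (𝓝 (y, (0 : ℝ))) (𝓝 (y + (0 : ℝ) • k)) :=
    Continuous.tendsto (by fun_prop) _
  rw [zero_smul, add_zero, nhds_prod_eq] at h1
  exact h1.mono_left (Filter.prod_mono le_rfl nhdsWithin_le_nhds)

theorem eventually_snd_pos {E : Type*} [TopologicalSpace E] (y : E) :
    ∀ᶠ p : E × ℝ in 𝓝 y ×ˢ 𝓝[>] (0 : ℝ), 0 < p.2 :=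
  tendsto_snd.eventually self_mem_nhdsWithin

theorem eventually_abs_quotient_le (hf : LipschitzOnWith L f U) (hU : U ∈ 𝓝 y) (h : E) :
    ∀ᶠ p : E × ℝ in 𝓝 y ×ˢ 𝓝[>] (0 : ℝ), |(f (p.1 + p.2 • h) - f p.1) / p.2| ≤ L * ‖h‖ := by
  filter_upwards [eventually_snd_pos y, tendsto_fst.eventually hU,
    (tendsto_add_smul_nhds_prod y h).eventually hU] with p hp h1 h2
  have h3 := hf.dist_le_mul _ h2 _ h1
  rw [Real.dist_eq, dist_eq_norm, add_sub_cancel_left, norm_smul, Real.norm_eq_abs,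
    abs_of_pos hp] at h3
  rw [abs_div, abs_of_pos hp, div_le_iff₀ hp]
  linarith

theorem clarkeDeriv_le_of_eventually (hf : LipschitzOnWith L f U) (hU : U ∈ 𝓝 y) {h : E} {b : ℝ}
    (hb : ∀ᶠ p : E × ℝ in 𝓝 y ×ˢ 𝓝[>] (0 : ℝ), (f (p.1 + p.2 • h) - f p.1) / p.2 ≤ b) :
    clarkeDeriv f y h ≤ b := by
  refine limsup_le_of_le ?_ hb
  exact IsBoundedUnder.isCoboundedUnder_le
    ⟨-(L * ‖h‖), (eventually_abs_quotient_le hf hU h).mono fun p hp => (abs_le.1 hp).1⟩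

theorem eventually_quotient_lt (hf : LipschitzOnWith L f U) (hU : U ∈ 𝓝 y) {h : E} {b : ℝ}
    (hb : clarkeDeriv f y h < b) :
    ∀ᶠ p : E × ℝ in 𝓝 y ×ˢ 𝓝[>] (0 : ℝ), (f (p.1 + p.2 • h) - f p.1) / p.2 < b :=
  eventually_lt_of_limsup_lt hb
    ⟨L * ‖h‖, (eventually_abs_quotient_le hf hU h).mono fun _ hp => (abs_le.1 hp).2⟩

theorem clarkeDeriv_le_mul_norm (hf : LipschitzOnWith L f U) (hU : U ∈ 𝓝 y) (h : E) :
    clarkeDeriv f y h ≤ L * ‖h‖ :=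
  clarkeDeriv_le_of_eventually hf hU
    ((eventually_abs_quotient_le hf hU h).mono fun _ hp => (abs_le.1 hp).2)

theorem clarkeDeriv_add_le (hf : LipschitzOnWith L f U) (hU : U ∈ 𝓝 y) (h k : E) :
    clarkeDeriv f y (h + k) ≤ clarkeDeriv f y h + clarkeDeriv f y k := by
  refine le_of_forall_pos_le_add fun δ hδ => clarkeDeriv_le_of_eventually hf hU ?_
  have hh := eventually_quotient_lt hf hU (show clarkeDeriv f y h < clarkeDeriv f y h + δ / 2
    by linarith)
  have hk := eventually_quotient_lt hf hU (show clarkeDeriv f y k < clarkeDeriv f y k + δ / 2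
    by linarith)
  filter_upwards [((tendsto_add_smul_nhds_prod y k).prodMk tendsto_snd).eventually hh, hk]
    with p h1 h2
  have h3 : (f (p.1 + p.2 • (h + k)) - f p.1) / p.2 =
      (f (p.1 + p.2 • k + p.2 • h) - f (p.1 + p.2 • k)) / p.2 +
        (f (p.1 + p.2 • k) - f p.1) / p.2 := by
    rw [show p.1 + p.2 • (h + k) = p.1 + p.2 • k + p.2 • h by rw [smul_add]; abel]
    ring
  rw [h3]
  linarith

theorem clarkeDeriv_smul_le (hf : LipschitzOnWith L f U) (hU : U ∈ 𝓝 y) {c : ℝ} (hc : 0 < c)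
    (h : E) : clarkeDeriv f y (c • h) ≤ c * clarkeDeriv f y h := by
  refine le_of_forall_pos_le_add fun δ hδ => clarkeDeriv_le_of_eventually hf hU ?_
  have hh := eventually_quotient_lt hf hU (show clarkeDeriv f y h < clarkeDeriv f y h + δ / c
    by have := div_pos hδ hc; linarith)
  have ht : Tendsto (fun t : ℝ => t * c) (𝓝[>] 0) (𝓝[>] 0) := by
    refine tendsto_nhdsWithin_iff.2 ⟨?_, ?_⟩
    · have h0 : Tendsto (fun t : ℝ => t * c) (𝓝 0) (𝓝 (0 * c)) :=
        Continuous.tendsto (by fun_prop) _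
      rw [zero_mul] at h0
      exact h0.mono_left nhdsWithin_le_nhds
    · filter_upwards [self_mem_nhdsWithin] with t ht
      exact mul_pos ht hc
  filter_upwards [(tendsto_fst.prodMk (ht.comp tendsto_snd)).eventually hh,
    eventually_snd_pos y] with p h1 hp
  simp only [Function.comp_apply] at h1
  rw [div_lt_iff₀ (mul_pos hp hc)] at h1
  rw [smul_smul, div_le_iff₀ hp]
  refine h1.le.trans (le_of_eq ?_)
  field_simp

end ClarkeDeriv

theorem exists_mem_clarkeGrad_inner_eq {f : X → ℝ} {L : ℝ≥0} {U : Set X} {y : X}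
    (hf : LipschitzOnWith L f U) (hU : U ∈ 𝓝 y) (h : X) :
    ∃ a ∈ clarkeGrad f y, ⟪a, h⟫ = clarkeDeriv f y h :=
  exists_inner_le_sublinear (clarkeDeriv f y) L (fun _ hc v => clarkeDeriv_smul_le hf hU hc v)
    (clarkeDeriv_add_le hf hU) (clarkeDeriv_le_mul_norm hf hU) h

/-- Proposition 2.1(2), support function property: for every `h`, the supremum of `⟪a,h⟫`
over `a ∈ ∂^ε f(x)` is attained and equals `f⁰_ε(x;h)`. -/
theorem epsDeriv_isGreatest_support
    (f : X → ℝ) (x : X) (ε : ℝ) (hε : 0 < ε) (L : ℝ≥0) (U : Set X)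
    (hU : IsOpen U) (hBU : Metric.closedBall x ε ⊆ U)
    (hf : LipschitzOnWith L f U) :
    ∀ h : X, IsGreatest ((fun a => ⟪a, h⟫) '' epsGrad f ε x) (epsDeriv f ε x h) := by
  have hnhds : ∀ y ∈ closedBall x ε, U ∈ 𝓝 y := fun y hy => hU.mem_nhds (hBU hy)
  have hle : ∀ y ∈ closedBall x ε, ∀ v, clarkeDeriv f y v ≤ epsDeriv f ε x v := by
    intro y hy v
    refine le_csSup ⟨L * ‖v‖, ?_⟩ (mem_image_of_mem _ hy)
    rintro _ ⟨z, hz, rfl⟩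
    exact clarkeDeriv_le_mul_norm hf (hnhds z hz) v
  have hsup : ∀ v b, (∀ y ∈ closedBall x ε, clarkeDeriv f y v ≤ b) → epsDeriv f ε x v ≤ b := by
    intro v b hb
    refine csSup_le ((nonempty_closedBall.2 hε.le).image _) ?_
    rintro _ ⟨z, hz, rfl⟩
    exact hb z hz
  intro h
  constructor
  · obtain ⟨a, ha, hah⟩ := exists_inner_le_sublinear (epsDeriv f ε x) L
      (fun c hc v => hsup _ _ fun y hy => (clarkeDeriv_smul_le hf (hnhds y hy) hc v).trans
        (mul_le_mul_of_nonneg_left (hle y hy v) hc.le))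
      (fun v w => hsup _ _ fun y hy => (clarkeDeriv_add_le hf (hnhds y hy) v w).trans
        (add_le_add (hle y hy v) (hle y hy w)))
      (fun v => hsup _ _ fun y hy => clarkeDeriv_le_mul_norm hf (hnhds y hy) v) h
    refine ⟨a, ?_, hah⟩
    by_contra hmem
    obtain ⟨g, u, hgu, hua⟩ := geometric_hahn_banach_closed_point
      (convex_convexHull ℝ (⋃ y ∈ closedBall x ε, clarkeGrad f y)).closure isClosed_closure hmem
    have hg : ∀ w, ⟪w, (InnerProductSpace.toDual ℝ X).symm g⟫ = g w := fun w => by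
      rw [real_inner_comm, InnerProductSpace.toDual_symm_apply]
    have h1 : epsDeriv f ε x ((InnerProductSpace.toDual ℝ X).symm g) ≤ u := by
      refine hsup _ _ fun y hy => ?_
      obtain ⟨b, hb, hbv⟩ := exists_mem_clarkeGrad_inner_eq hf (hnhds y hy)
        ((InnerProductSpace.toDual ℝ X).symm g)
      rw [← hbv, hg]
      exact (hgu b (subset_closure (subset_convexHull ℝ _ (mem_biUnion hy hb)))).le
    have h2 := ha ((InnerProductSpace.toDual ℝ X).symm g)
    rw [hg] at h2
    linarith
  · rintro _ ⟨a, ha, rfl⟩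
    have hclosed : IsClosed {a : X | ⟪a, h⟫ ≤ epsDeriv f ε x h} :=
      isClosed_le (by fun_prop) continuous_const
    have hconvex : Convex ℝ {a : X | ⟪a, h⟫ ≤ epsDeriv f ε x h} :=
      convex_halfSpace_le ⟨fun v w => inner_add_left v w h,
        fun c v => real_inner_smul_left v h c⟩ _
    refine closure_minimal (convexHull_min ?_ hconvex) hclosed ha
    exact iUnion₂_subset fun y hy b hb => (hb h).trans (hle y hy h)
end

section
/- Let f : X → ℝ be locally Lipschitz continuous and let x ∈ X with 0 ∉ ∂f(x). Then there exist ε > 0 and h ∈ X with ‖h‖ = 1 such that −‖a‖ ≤ ⟨a,h⟩ ≤ f⁰_ε(x;h) < 0 for all a ∈ ∂^ε f(x); in particular 0 ∉ ∂^ε f(x). -/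
open Filter Metric Set Topology MeasureTheory
open scoped RealInnerProductSpace NNReal

variable {X : Type*} [NormedAddCommGroup X] [InnerProductSpace ℝ X] [CompleteSpace X]

/-- Near `(y, 0⁺)` the difference quotients of a locally Lipschitz function are bounded. -/
theorem LocallyLipschitz.eventually_abs_differenceQuotient_le {f : X → ℝ}
    (hf : LocallyLipschitz f) (y h : X) :
    ∃ C : ℝ, ∀ᶠ p : X × ℝ in 𝓝 y ×ˢ 𝓝[>] (0 : ℝ),
      |(f (p.1 + p.2 • h) - f p.1) / p.2| ≤ C := by
  obtain ⟨K, t, ht, hK⟩ := hf y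
  refine ⟨K * ‖h‖, ?_⟩
  have hle : 𝓝 y ×ˢ 𝓝[>] (0 : ℝ) ≤ 𝓝 (y, (0 : ℝ)) := by
    rw [nhds_prod_eq]
    exact Filter.prod_mono le_rfl nhdsWithin_le_nhds
  have hcont : Tendsto (fun p : X × ℝ => p.1 + p.2 • h) (𝓝 (y, (0 : ℝ))) (𝓝 y) := by
    have : Continuous (fun p : X × ℝ => p.1 + p.2 • h) := by fun_prop
    simpa using this.tendsto (y, (0 : ℝ))
  have hpos : ∀ᶠ p : X × ℝ in 𝓝 y ×ˢ 𝓝[>] (0 : ℝ), 0 < p.2 :=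
    tendsto_snd.eventually self_mem_nhdsWithin
  filter_upwards [(hcont.mono_left hle).eventually ht, tendsto_fst.eventually ht, hpos]
    with p h₁ h₂ h₃
  have hd := hK.dist_le_mul _ h₁ _ h₂
  rw [Real.dist_eq, dist_eq_norm, add_sub_cancel_left, norm_smul, Real.norm_eq_abs,
    abs_of_pos h₃] at hd
  rw [abs_div, abs_of_pos h₃, div_le_iff₀ h₃]
  linarith

/-- A uniform upper bound on difference quotients near `(y, 0⁺)` bounds the Clarke derivative. -/
theorem clarkeDeriv_le_of_eventually_le {f : X → ℝ} (hf : LocallyLipschitz f) {y h : X} {c : ℝ}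
    (hc : ∀ᶠ p : X × ℝ in 𝓝 y ×ˢ 𝓝[>] (0 : ℝ), (f (p.1 + p.2 • h) - f p.1) / p.2 ≤ c) :
    clarkeDeriv f y h ≤ c := by
  obtain ⟨C, hC⟩ := hf.eventually_abs_differenceQuotient_le y h
  refine limsup_le_of_le ?_ hc
  exact IsBoundedUnder.isCoboundedUnder_le ⟨-C, eventually_map.2 (hC.mono fun p hp => (abs_le.1 hp).1)⟩

/-- If the Clarke derivative is less than `c`, so are the difference quotients near `(y, 0⁺)`. -/
theorem eventually_lt_of_clarkeDeriv_lt {f : X → ℝ} (hf : LocallyLipschitz f) {y h : X} {c : ℝ}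
    (hc : clarkeDeriv f y h < c) :
    ∀ᶠ p : X × ℝ in 𝓝 y ×ˢ 𝓝[>] (0 : ℝ), (f (p.1 + p.2 • h) - f p.1) / p.2 < c := by
  obtain ⟨C, hC⟩ := hf.eventually_abs_differenceQuotient_le y h
  exact eventually_lt_of_limsup_lt hc
    ⟨C, eventually_map.2 (hC.mono fun p hp => (abs_le.1 hp).2)⟩

/-- A negative Clarke derivative at `x` gives a unit direction along which the Clarke derivatives
are bounded above by a negative constant on a ball about `x`. -/
theorem exists_unit_clarkeDeriv_le_of_neg {f : X → ℝ} (hf : LocallyLipschitz f) {x h : X}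
    (hneg : clarkeDeriv f x h < 0) :
    ∃ ε > (0 : ℝ), ∃ u : X, ‖u‖ = 1 ∧ ∃ c < (0 : ℝ),
      ∀ y ∈ closedBall x ε, clarkeDeriv f y u ≤ c := by
  obtain ⟨c, hc, hc0⟩ := exists_between hneg
  have hev := eventually_lt_of_clarkeDeriv_lt hf hc
  have hh : h ≠ 0 := by
    rintro rfl
    obtain ⟨p, hp⟩ := hev.exists
    simp only [smul_zero, add_zero, sub_self, zero_div] at hp
    exact hp.not_gt hc0
  have hn : 0 < ‖h‖ := norm_pos_iff.2 hh
  obtain ⟨P, hP, Q, hQ, hPQ⟩ := eventually_prod_iff.1 hev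
  obtain ⟨δ, hδ, hball⟩ := Metric.eventually_nhds_iff_ball.1 hP
  refine ⟨δ / 2, half_pos hδ, ‖h‖⁻¹ • h, ?_, c * ‖h‖⁻¹, mul_neg_of_neg_of_pos hc0 (inv_pos.2 hn), ?_⟩
  · rw [norm_smul, norm_inv, norm_norm, inv_mul_cancel₀ hn.ne']
  intro y hy
  apply clarkeDeriv_le_of_eventually_le hf
  have hyb : y ∈ ball x δ := closedBall_subset_ball (half_lt_self hδ) hy
  have hscale : Tendsto (fun t : ℝ => t * ‖h‖⁻¹) (𝓝[>] 0) (𝓝[>] 0) := by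
    refine tendsto_nhdsWithin_iff.2 ⟨?_, ?_⟩
    · have : Continuous (fun t : ℝ => t * ‖h‖⁻¹) := by fun_prop
      simpa using (this.tendsto 0).mono_left nhdsWithin_le_nhds
    · filter_upwards [self_mem_nhdsWithin] with t ht
      exact mul_pos ht (inv_pos.2 hn)
  filter_upwards [prod_mem_prod (isOpen_ball.mem_nhds hyb) (hscale.eventually hQ)]
    with p ⟨hp₁, hp₂⟩
  have key := hPQ (hball _ hp₁) hp₂
  have heq : (f (p.1 + p.2 • ‖h‖⁻¹ • h) - f p.1) / p.2 =
      (f (p.1 + (p.2 * ‖h‖⁻¹) • h) - f p.1) / (p.2 * ‖h‖⁻¹) * ‖h‖⁻¹ := by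
    rw [smul_smul]
    field_simp
  rw [heq]
  exact mul_le_mul_of_nonneg_right key.le (inv_nonneg.2 hn.le)

/-- Lemma 2.2: if `0 ∉ ∂f(x)`, there are `ε > 0` and a unit vector `h` with
`-‖a‖ ≤ ⟪a,h⟫ ≤ f⁰_ε(x;h) < 0` for all `a ∈ ∂^ε f(x)`; in particular `0 ∉ ∂^ε f(x)`. -/
theorem exists_eps_unit_descent_of_not_mem_clarkeGrad
    (f : X → ℝ) (hf : LocallyLipschitz f) (x : X)
    (hx : (0 : X) ∉ clarkeGrad f x) :
    ∃ ε > (0:ℝ), ∃ h : X, ‖h‖ = 1 ∧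
      (∀ a ∈ epsGrad f ε x, -‖a‖ ≤ ⟪a, h⟫ ∧ ⟪a, h⟫ ≤ epsDeriv f ε x h) ∧
      epsDeriv f ε x h < 0 ∧ (0 : X) ∉ epsGrad f ε x := by
  have hneg : ∃ h : X, clarkeDeriv f x h < 0 := by
    by_contra! hcon
    exact hx fun h => by simpa using hcon h
  obtain ⟨h₀, hh₀⟩ := hneg
  obtain ⟨ε, hε, u, hu, c, hc, hle⟩ := exists_unit_clarkeDeriv_le_of_neg hf hh₀
  have hlt : epsDeriv f ε x u < 0 := by
    refine lt_of_le_of_lt (csSup_le ((nonempty_closedBall.2 hε.le).image _) ?_) hc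
    rintro _ ⟨y, hy, rfl⟩
    exact hle y hy
  have hbdd : BddAbove ((fun y => clarkeDeriv f y u) '' closedBall x ε) := by
    refine ⟨c, ?_⟩
    rintro _ ⟨y, hy, rfl⟩
    exact hle y hy
  have hsub : epsGrad f ε x ⊆ {a | ⟪a, u⟫ ≤ epsDeriv f ε x u} := by
    refine closure_minimal (convexHull_min ?_ ?_) ?_
    · refine iUnion₂_subset fun y hy a ha => ?_
      exact (ha u).trans (le_csSup hbdd (mem_image_of_mem _ hy))
    · exact convex_halfSpace_le
        ⟨fun a b => inner_add_left a b u, fun r a => real_inner_smul_left a u r⟩ _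
    · exact isClosed_le (by fun_prop) continuous_const
  refine ⟨ε, hε, u, hu, fun a ha => ⟨?_, hsub ha⟩, hlt, fun h0 => ?_⟩
  · have := (abs_le.1 (abs_real_inner_le_norm a u)).1
    rwa [hu, mul_one] at this
  · have h0' : ⟪(0 : X), u⟫ ≤ epsDeriv f ε x u := hsub h0
    rw [inner_zero_left] at h0'
    exact h0'.not_gt hlt
end

section
/- Let U ⊆ X be an open convex set, let f : X → ℝ be convex on U, let a ∈ X with a ≠ 0, let h := a/‖a‖, let ε > 0 and x ∈ X with the segment [x, x − 2εh] contained in U, and let 0 < δ < δ'. Assume f(x − εh) − f(x) > −δ·ε·‖a‖. Then every subgradient b of f at x − εh (i.e. every b ∈ X with f(z) ≥ f(x−εh) + ⟨b, z − (x−εh)⟩ for all z ∈ U) satisfies ⟨a,b⟩ < δ'·‖a‖². (Hence in the convex case the inner bisection subalgorithm terminates already at the first midpoint.) -/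
open Filter Metric Set Topology MeasureTheory
open scoped RealInnerProductSpace NNReal

variable {X : Type*} [NormedAddCommGroup X] [InnerProductSpace ℝ X] [CompleteSpace X]

/-- Proposition 3.5(4): in the convex case, every subgradient at the first midpoint
`x - εh` already satisfies the required inequality. -/
theorem convex_case_first_midpoint
    (f : X → ℝ) (U : Set X) (hU : IsOpen U) (hUconv : Convex ℝ U)
    (hfconv : ConvexOn ℝ U f)
    (a : X) (ha : a ≠ 0) (ε : ℝ) (hε : 0 < ε)
    (x : X) (hseg : segment ℝ x (x - (2 * ε) • (‖a‖⁻¹ • a)) ⊆ U)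
    (δ δ' : ℝ) (hδ : 0 < δ) (hδδ' : δ < δ')
    (hviol : f (x - ε • (‖a‖⁻¹ • a)) - f x > -δ * ε * ‖a‖) :
    ∀ b : X, (∀ z ∈ U, f (x - ε • (‖a‖⁻¹ • a)) + ⟪b, z - (x - ε • (‖a‖⁻¹ • a))⟫ ≤ f z) →
      ⟪a, b⟫ < δ' * ‖a‖ ^ 2 := by
  intro b hb
  have hnorm : 0 < ‖a‖ := norm_pos_iff.mpr ha
  have hsub := hb x (hseg (left_mem_segment ℝ _ _))
  rw [sub_sub_cancel, inner_smul_right, inner_smul_right, real_inner_comm] at hsub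
  have hlt : ε * (‖a‖⁻¹ * ⟪a, b⟫) < ε * (δ * ‖a‖) := by linarith
  have hdiv : ‖a‖⁻¹ * ⟪a, b⟫ < δ * ‖a‖ := lt_of_mul_lt_mul_left hlt hε.le
  rw [inv_mul_lt_iff₀ hnorm] at hdiv
  calc ⟪a, b⟫ < ‖a‖ * (δ * ‖a‖) := hdiv
    _ = δ * ‖a‖ ^ 2 := by ring
    _ < δ' * ‖a‖ ^ 2 := by gcongr
end

section
/- Let X be a real Hilbert space, let γ ∈ [0,1) and L > 0 be constants, and let (a_j)_{j∈ℕ} and (b_j)_{j∈ℕ} be sequences in X such that for all j ∈ ℕ: (i) ⟨a_j, b_j⟩ ≤ γ·‖a_j‖², (ii) ‖b_j‖ ≤ L, and (iii) ‖a_{j+1}‖ ≤ ‖λ·a_j + (1−λ)·b_j‖ for every λ ∈ [0,1]. Then ‖a_j‖ → 0 as j → ∞. -/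
open Filter Topology
open scoped RealInnerProductSpace

/-- Expansion of the squared norm of a convex combination, bounded by a quadratic in the weight. -/
lemma norm_sq_convex_combination_le {X : Type*} [NormedAddCommGroup X] [InnerProductSpace ℝ X]
    {γ L t : ℝ} {x y : X} (hγ0 : 0 ≤ γ) (hxy : ⟪x, y⟫ ≤ γ * ‖x‖ ^ 2) (hy : ‖y‖ ≤ L)
    (ht0 : 0 ≤ t) (ht1 : t ≤ 1) :
    ‖(1 - t) • x + t • y‖ ^ 2 ≤
      ‖x‖ ^ 2 - 2 * t * (1 - γ) * ‖x‖ ^ 2 + t ^ 2 * (‖x‖ ^ 2 + L ^ 2) := by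
  rw [norm_add_sq_real, norm_smul, norm_smul, real_inner_smul_left, real_inner_smul_right,
    mul_pow, mul_pow, Real.norm_eq_abs, Real.norm_eq_abs, sq_abs, sq_abs]
  have hy2 : t ^ 2 * ‖y‖ ^ 2 ≤ t ^ 2 * L ^ 2 := by gcongr
  have hinner : (t * (1 - t)) * ⟪x, y⟫ ≤ (t * (1 - t)) * (γ * ‖x‖ ^ 2) :=
    mul_le_mul_of_nonneg_left hxy (mul_nonneg ht0 (sub_nonneg.2 ht1))
  have hγt : 0 ≤ t ^ 2 * γ * ‖x‖ ^ 2 := by positivity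
  linarith

/-- Lemma 3.7: the norms of the recursively minimized convex combinations tend to zero. -/
theorem norm_tendsto_zero_of_convex_min_recursion
    {X : Type*} [NormedAddCommGroup X] [InnerProductSpace ℝ X]
    (γ L : ℝ) (hγ0 : 0 ≤ γ) (hγ1 : γ < 1) (hL : 0 < L)
    (a b : ℕ → X)
    (hab : ∀ j, ⟪a j, b j⟫ ≤ γ * ‖a j‖ ^ 2)
    (hb : ∀ j, ‖b j‖ ≤ L)
    (hmin : ∀ j, ∀ l ∈ Set.Icc (0:ℝ) 1, ‖a (j+1)‖ ≤ ‖l • a j + (1 - l) • b j‖) :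
    Tendsto (fun j => ‖a j‖) atTop (𝓝 0) := by
  have hanti : Antitone fun j => ‖a j‖ :=
    antitone_nat_of_succ_le fun j => by simpa using hmin j 1 (by simp)
  have hbdd : BddBelow (Set.range fun j => ‖a j‖) :=
    ⟨0, by rintro _ ⟨j, rfl⟩; exact norm_nonneg _⟩
  obtain ⟨m, hm⟩ : ∃ m, Tendsto (fun j => ‖a j‖) atTop (𝓝 m) :=
    ⟨_, tendsto_atTop_ciInf hanti hbdd⟩
  have hlim : ∀ t : ℝ, 0 ≤ t → t ≤ 1 →
      m ^ 2 ≤ m ^ 2 - 2 * t * (1 - γ) * m ^ 2 + t ^ 2 * (m ^ 2 + L ^ 2) := by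
    intro t ht0 ht1
    have hsq := hm.pow 2
    refine le_of_tendsto_of_tendsto' (hsq.comp (tendsto_add_atTop_nat 1))
      ((hsq.sub (hsq.const_mul _)).add ((hsq.add_const _).const_mul _)) fun j => ?_
    have hstep := hmin j (1 - t) ⟨by linarith, by linarith⟩
    rw [sub_sub_cancel] at hstep
    exact (pow_le_pow_left₀ (norm_nonneg _) hstep 2).trans
      (norm_sq_convex_combination_le hγ0 (hab j) (hb j) ht0 ht1)
  suffices m = 0 by rwa [this] at hm
  by_contra hm0
  have hm2 : 0 < m ^ 2 := by positivity
  have hden : 0 < m ^ 2 + L ^ 2 := by positivity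
  have hnum : 0 < (1 - γ) * m ^ 2 := mul_pos (by linarith) hm2
  obtain ⟨t, ht⟩ : ∃ t, t = (1 - γ) * m ^ 2 / (m ^ 2 + L ^ 2) := ⟨_, rfl⟩
  have ht0 : 0 < t := ht ▸ div_pos hnum hden
  have ht1 : t ≤ 1 := by
    rw [ht, div_le_one hden]
    nlinarith [sq_nonneg L]
  have htmul : t * (m ^ 2 + L ^ 2) = (1 - γ) * m ^ 2 := by
    rw [ht, div_mul_cancel₀ _ hden.ne']
  have hle := hlim t ht0.le ht1
  rw [pow_two t, mul_assoc t t, htmul] at hle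
  linarith [mul_pos ht0 hnum]
end

section
/- (Accumulation points of the descent algorithm are critical points.) Under the algorithm assumptions stated in the context, let (x_k), (ε_k), (σ_k), (i_k), (a_k), (â_k), (ε_{k,i}) be as described there. Then the sequence (f(x_k)) is strictly decreasing, and if x ∈ X is an accumulation point of (x_k) (i.e. the limit of some subsequence), then 0 ∈ ∂f(x) and f(x_k) → f(x). -/
open Filter Metric Set Topology MeasureTheory
open scoped RealInnerProductSpace NNReal

variable {X : Type*} [NormedAddCommGroup X] [InnerProductSpace ℝ X] [CompleteSpace X]

/-- The norm induced by the bilinear form `B k`. -/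
noncomputable def normk (B : ℕ → X →L[ℝ] X →L[ℝ] ℝ) (k : ℕ) (u : X) : ℝ :=
  Real.sqrt (B k u u)

/-- Clarke's generalized gradient with respect to the inner product `B k`. -/
noncomputable def gradk (f : X → ℝ) (B : ℕ → X →L[ℝ] X →L[ℝ] ℝ) (k : ℕ) (x : X) : Set X :=
  {a | ∀ h : X, B k a h ≤ clarkeDeriv f x h}

/-- The gradient of `f` on the `‖·‖ₖ`-ball of radius `ε` about `x`,
taken with respect to the inner product `B k`. -/
noncomputable def epsGradk (f : X → ℝ) (B : ℕ → X →L[ℝ] X →L[ℝ] ℝ) (k : ℕ)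
    (ε : ℝ) (x : X) : Set X :=
  closure (convexHull ℝ (⋃ y ∈ {y : X | normk B k (y - x) ≤ ε}, gradk f B k y))

section InnerProductSpace

variable {E : Type*} [NormedAddCommGroup E] [InnerProductSpace ℝ E]

/-- Difference quotients of a locally Lipschitz function are bounded near every point. -/
lemma exists_eventually_abs_quotient_le {f : E → ℝ} (hf : LocallyLipschitz f) (x h : E) :
    ∃ M : ℝ, ∀ᶠ p : E × ℝ in (𝓝 x) ×ˢ (𝓝[>] (0:ℝ)), |(f (p.1 + p.2 • h) - f p.1) / p.2| ≤ M := by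
  obtain ⟨K, t, ht, hK⟩ := hf x
  refine ⟨K * ‖h‖, ?_⟩
  have hshift : Tendsto (fun p : E × ℝ => p.1 + p.2 • h) ((𝓝 x) ×ˢ (𝓝[>] (0:ℝ))) (𝓝 x) := by
    have hc : Tendsto (fun p : E × ℝ => p.1 + p.2 • h) (𝓝 (x, 0)) (𝓝 (x + (0:ℝ) • h)) :=
      Continuous.tendsto (f := fun p : E × ℝ => p.1 + p.2 • h) (by fun_prop) (x, 0)
    rw [zero_smul, add_zero, nhds_prod_eq] at hc
    exact hc.mono_left (Filter.prod_mono_right _ nhdsWithin_le_nhds)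
  filter_upwards [hshift.eventually ht, tendsto_fst.eventually ht,
    tendsto_snd.eventually self_mem_nhdsWithin] with p hp₁ hp₂ hp₃
  have hpos : 0 < p.2 := hp₃
  have hlip := hK.dist_le_mul _ hp₁ _ hp₂
  rw [Real.dist_eq, dist_eq_norm, add_sub_cancel_left, norm_smul, Real.norm_eq_abs,
    abs_of_pos hpos] at hlip
  rw [abs_div, abs_of_pos hpos, div_le_iff₀ hpos]
  linarith

/-- Upper semicontinuity of `y ↦ f⁰(y; h)`. -/
lemma eventually_clarkeDeriv_le {f : E → ℝ} (hf : LocallyLipschitz f) {x h : E} {c : ℝ}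
    (hc : clarkeDeriv f x h < c) : ∀ᶠ y in 𝓝 x, clarkeDeriv f y h ≤ c := by
  obtain ⟨M, hM⟩ := exists_eventually_abs_quotient_le hf x h
  have hlt := eventually_lt_of_limsup_lt hc
    (isBoundedUnder_of_eventually_le (hM.mono fun p hp => (abs_le.1 hp).2))
  obtain ⟨pa, hpa, pb, hpb, hab⟩ := eventually_prod_iff.1 hlt
  filter_upwards [hpa.eventually_nhds] with y hy
  obtain ⟨M', hM'⟩ := exists_eventually_abs_quotient_le hf y h
  refine limsup_le_of_le
    (isBoundedUnder_of_eventually_ge (hM'.mono fun p hp => (abs_le.1 hp).1)).isCoboundedUnder_le ?_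
  filter_upwards [tendsto_fst.eventually hy, tendsto_snd.eventually hpb] with p hp₁ hp₂
  exact (hab hp₁ hp₂).le

section VaryingInnerProduct

variable {B : ℕ → E →L[ℝ] E →L[ℝ] ℝ} {C : ℝ} {k : ℕ}

lemma apply_self_nonneg_of_norm_le_normk (hC : 0 < C)
    (hlow : ∀ u : E, (1 / C) * ‖u‖ ≤ normk B k u) (u : E) : 0 ≤ B k u u := by
  rcases eq_or_ne u 0 with rfl | hu
  · simp
  · have hpos : 0 < normk B k u :=
      (mul_pos (one_div_pos.2 hC) (norm_pos_iff.2 hu)).trans_le (hlow u)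
    exact (Real.sqrt_pos.1 hpos).le

/-- The Cauchy–Schwarz inequality for the inner product `B k`. -/
lemma abs_apply_le_normk_mul_normk (hsymm : ∀ u v : E, B k u v = B k v u)
    (hnonneg : ∀ u : E, 0 ≤ B k u u) (u v : E) :
    |B k u v| ≤ normk B k u * normk B k v := by
  rw [normk, normk, ← Real.sqrt_mul (hnonneg u)]
  refine Real.abs_le_sqrt ?_
  exact LinearMap.BilinForm.apply_sq_le_of_symm ((ContinuousLinearMap.coeLM ℝ).comp
    (B k).toLinearMap) hnonneg ⟨hsymm⟩ u v

/-- The `ε`-gradient lies in every half-space that contains all gradients on the ball. -/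
lemma apply_le_of_mem_epsGradk {f : E → ℝ} {ε c : ℝ} {x h b : E}
    (hle : ∀ y, normk B k (y - x) ≤ ε → clarkeDeriv f y h ≤ c)
    (hb : b ∈ epsGradk f B k ε x) : B k b h ≤ c := by
  have hclosed : IsClosed {v : E | B k v h ≤ c} :=
    isClosed_le (by fun_prop) continuous_const
  have hconvex : Convex ℝ {v : E | B k v h ≤ c} :=
    convex_halfSpace_le (f := fun v => B k v h)
      ⟨fun u v => by simp, fun r u => by simp⟩ c
  refine closure_minimal (convexHull_min ?_ hconvex) hclosed hb
  intro v hv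
  obtain ⟨y, hy, hvy⟩ := mem_iUnion₂.1 hv
  exact (hvy h).trans (hle y hy)

end VaryingInnerProduct

/-- Near a non-critical point all gradients and `ε`-gradients with small `ε` are bounded away
from zero, uniformly in the inner product. -/
lemma exists_le_normk_of_zero_notMem_clarkeGrad {f : E → ℝ} (hf : LocallyLipschitz f)
    {C : ℝ} (hC : 0 < C) {B : ℕ → E →L[ℝ] E →L[ℝ] ℝ}
    (hsymm : ∀ k (u v : E), B k u v = B k v u)
    (hlow : ∀ k (u : E), (1 / C) * ‖u‖ ≤ normk B k u)
    (hhigh : ∀ k (u : E), normk B k u ≤ C * ‖u‖) {z : E} (hz : (0 : E) ∉ clarkeGrad f z) :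
    ∃ m > 0, ∃ r > 0, ∀ k y, ‖y - z‖ < r →
      (∀ b ∈ gradk f B k y, m ≤ normk B k b) ∧
      ∀ ε < r, ∀ b ∈ epsGradk f B k ε y, m ≤ normk B k b := by
  obtain ⟨h, hneg⟩ : ∃ h, clarkeDeriv f z h < 0 := by
    simpa [clarkeGrad] using hz
  obtain ⟨c, hzc, hc⟩ := exists_between hneg
  obtain ⟨R, hR, hball⟩ := Metric.eventually_nhds_iff.1 (eventually_clarkeDeriv_le hf hzc)
  have hbound : ∀ k b, B k b h ≤ c → -c / (C * (‖h‖ + 1)) ≤ normk B k b := by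
    intro k b hb
    have hcs := abs_apply_le_normk_mul_normk (hsymm k)
      (apply_self_nonneg_of_norm_le_normk hC (hlow k)) b h
    have hnn : 0 ≤ normk B k b := Real.sqrt_nonneg _
    rw [div_le_iff₀ (by positivity)]
    calc -c ≤ |B k b h| := by linarith [neg_le_abs (B k b h)]
      _ ≤ normk B k b * normk B k h := hcs
      _ ≤ normk B k b * (C * (‖h‖ + 1)) := by
        gcongr
        exact (hhigh k h).trans (by gcongr; linarith)
  refine ⟨-c / (C * (‖h‖ + 1)), div_pos (by linarith) (by positivity), R / (1 + C),
    by positivity, fun k y hy => ⟨fun b hb => hbound k b ((hb h).trans (hball ?_)),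
      fun ε hε b hb => hbound k b (apply_le_of_mem_epsGradk (fun w hw => hball ?_) hb)⟩⟩
  · rw [dist_eq_norm]
    exact hy.trans_le (div_le_self hR.le (by linarith))
  · have hwy : ‖w - y‖ ≤ C * ε := by
      have := (hlow k (w - y)).trans hw
      rwa [one_div, inv_mul_le_iff₀ hC] at this
    have hCε : C * ε < C * (R / (1 + C)) := by gcongr
    have hsum : C * (R / (1 + C)) + R / (1 + C) = R := by
      field_simp
      ring
    rw [dist_eq_norm]
    linarith [norm_sub_le_norm_sub_add_norm_sub w y z]

end InnerProductSpace

/-- If `t * T t` is eventually small and `T` is positive and nondecreasing, `t` is eventually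
small. -/
lemma tendsto_zero_of_mul_apply_tendsto_zero {T : ℝ → ℝ} (hpos : ∀ t : ℝ, 0 < t → 0 < T t)
    (hmono : MonotoneOn T (Ioi 0)) {e : ℕ → ℝ} (he : ∀ k, 0 < e k)
    (hlim : Tendsto (fun k => e k * T (e k)) atTop (𝓝 0)) : Tendsto e atTop (𝓝 0) := by
  refine (nhdsGT_basis (0:ℝ)).tendsto_right_iff.2 ?_ |>.mono_right nhdsWithin_le_nhds
  intro r hr
  filter_upwards [hlim.eventually_lt_const (mul_pos hr (hpos r hr))] with k hk
  refine ⟨he k, lt_of_not_ge fun hle => hk.not_ge ?_⟩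
  exact mul_le_mul hle (hmono hr (he k) hle) (hpos r hr).le (he k).le

/-- Theorem 3.10: the values `f(x_k)` are strictly decreasing and every accumulation
point `z` of the iteration points is a critical point, with `f(x_k) → f(z)`. -/
theorem accumulation_points_are_critical
    (f : X → ℝ) (hf : LocallyLipschitz f)
    (C : ℝ) (hC : 1 ≤ C)
    (B : ℕ → X →L[ℝ] X →L[ℝ] ℝ)
    (hBsymm : ∀ k (u v : X), B k u v = B k v u)
    (hBlow : ∀ k (u : X), (1 / C) * ‖u‖ ≤ normk B k u)
    (hBhigh : ∀ k (u : X), normk B k u ≤ C * ‖u‖)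
    (δ : ℝ) (hδ : δ ∈ Set.Ioo (0:ℝ) 1)
    (T₁ T₂ : ℝ → ℝ)
    (hT₁pos : ∀ t : ℝ, 0 < t → 0 < T₁ t) (hT₁mono : MonotoneOn T₁ (Set.Ioi 0))
    (hT₁lim : Tendsto T₁ (𝓝[>] (0:ℝ)) (𝓝 0))
    (hT₂pos : ∀ t : ℝ, 0 < t → 0 < T₂ t) (hT₂mono : MonotoneOn T₂ (Set.Ioi 0))
    (hT₂lim : ∀ t : ℝ, 0 < t → Tendsto (fun n => T₂^[n] t) atTop (𝓝 0))
    (G : ℝ → ℝ → ℝ) (hGpos : ∀ s t : ℝ, 0 < s → 0 < t → 0 < G s t)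
    (hG : (∀ s t : ℕ → ℝ, (∀ k, 0 < s k) → (∀ k, 0 < t k) →
            Tendsto (fun k => G (s k) (t k)) atTop (𝓝 0) →
            Tendsto s atTop (𝓝 0)) ∨
          (∀ s₀ : ℝ, 0 < s₀ → ∃ t₀ > (0:ℝ), ∀ s t : ℝ, s₀ < s → 0 < t → t < t₀ →
            t ≤ G s t))
    (x : ℕ → X) (εs : ℕ → ℝ) (hεspos : ∀ k, 0 < εs k)
    (σ : ℕ → ℝ) (hσpos : ∀ k, 0 < σ k) (ik : ℕ → ℕ)
    (a : ℕ → X) (hak : ∀ k, a k ∈ gradk f B k (x k))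
    (εki : ℕ → ℕ → ℝ)
    (hεki0 : ∀ k, G (normk B k (a k)) (εs k) ≤ εki k 0)
    (hεkiS : ∀ k, ∀ i < ik k, εki k (i+1) = T₂ (εki k i))
    (hnull : ∀ k, ∀ i < ik k,
      ∃ a' ∈ epsGradk f B k (εki k i) (x k), normk B k a' < T₁ (εki k i))
    (hεsS : ∀ k, εs (k+1) = εki k (ik k))
    (ahat : ℕ → X) (hahatmem : ∀ k, ahat k ∈ epsGradk f B k (εs (k+1)) (x k))
    (hahatnotnull : ∀ k, T₁ (εs (k+1)) ≤ normk B k (ahat k))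
    (hσε : ∀ k, εs (k+1) ≤ σ k)
    (hxS : ∀ k, x (k+1) = x k - (σ k / normk B k (ahat k)) • ahat k)
    (hdesc : ∀ k, f (x (k+1)) - f (x k) ≤ -δ * σ k * normk B k (ahat k)) :
    StrictAnti (fun k => f (x k)) ∧
    ∀ z : X, (∃ φ : ℕ → ℕ, StrictMono φ ∧ Tendsto (fun n => x (φ n)) atTop (𝓝 z)) →
      (0 : X) ∈ clarkeGrad f z ∧ Tendsto (fun k => f (x k)) atTop (𝓝 (f z)) := by
  obtain ⟨hδ₀, -⟩ := hδ
  have hC₀ : 0 < C := by linarith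
  have hahatpos : ∀ k, 0 < normk B k (ahat k) := fun k =>
    (hT₁pos _ (hεspos (k+1))).trans_le (hahatnotnull k)
  have hanti : StrictAnti (fun k => f (x k)) := by
    refine strictAnti_nat_of_succ_lt fun k => ?_
    have hk : 0 < δ * σ k * normk B k (ahat k) :=
      mul_pos (mul_pos hδ₀ (hσpos k)) (hahatpos k)
    linarith [hdesc k]
  refine ⟨hanti, ?_⟩
  rintro z ⟨φ, hφ, hφz⟩
  have hfz : Tendsto (fun k => f (x k)) atTop (𝓝 (f z)) :=
    (tendsto_iff_tendsto_subseq_of_antitone hanti.antitone hφ.tendsto_atTop).2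
      ((hf.continuous.tendsto z).comp hφz)
  refine ⟨?_, hfz⟩
  by_contra hz
  have hfge : ∀ k, f z ≤ f (x k) := hanti.antitone.le_of_tendsto hfz
  have hdiff : Tendsto (fun k => (f (x k) - f (x (k+1))) / δ) atTop (𝓝 0) := by
    simpa using (hfz.sub (hfz.comp (tendsto_add_atTop_nat 1))).div_const δ
  have hstep : ∀ k, σ k * normk B k (ahat k) ≤ (f (x k) - f (x (k+1))) / δ := fun k => by
    rw [le_div_iff₀ hδ₀]
    linarith [hdesc k]
  have hεlim' : Tendsto (fun k => εs (k+1)) atTop (𝓝 0) := by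
    refine tendsto_zero_of_mul_apply_tendsto_zero hT₁pos hT₁mono (fun k => hεspos (k+1)) ?_
    refine squeeze_zero (fun k => (mul_pos (hεspos _) (hT₁pos _ (hεspos _))).le)
      (fun k => ?_) hdiff
    exact (mul_le_mul (hσε k) (hahatnotnull k) (hT₁pos _ (hεspos _)).le (hσpos k).le).trans
      (hstep k)
  have hεlim : Tendsto εs atTop (𝓝 0) := (tendsto_add_atTop_iff_nat 1).1 hεlim'
  obtain ⟨m, hm, r, hr, hnear⟩ :=
    exists_le_normk_of_zero_notMem_clarkeGrad hf hC₀ hBsymm hBlow hBhigh hz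
  have hsmall : ∀ᶠ k in atTop, εs (k+1) < r := hεlim'.eventually_lt_const hr
  have hpot : Tendsto (fun n => ‖x (φ n) - z‖ + C / (δ * m) * (f (x (φ n)) - f z)) atTop
      (𝓝 0) := by
    simpa using (tendsto_iff_norm_sub_tendsto_zero.1 hφz).add
      (((hfz.comp hφ.tendsto_atTop).sub_const (f z)).const_mul (C / (δ * m)))
  obtain ⟨N, hN⟩ := eventually_atTop.1 hsmall
  obtain ⟨n, hn, hnN⟩ := ((hpot.eventually_lt_const hr).and
    (hφ.tendsto_atTop.eventually_ge_atTop N)).exists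
  have hnorm_lt : ∀ k, ‖x k - z‖ + C / (δ * m) * (f (x k) - f z) < r → ‖x k - z‖ < r := by
    intro k hk
    have : 0 ≤ C / (δ * m) * (f (x k) - f z) :=
      mul_nonneg (by positivity) (sub_nonneg.2 (hfge k))
    linarith
  have hstay : ∀ k ≥ φ n, ‖x k - z‖ + C / (δ * m) * (f (x k) - f z) < r := by
    intro k hk
    induction k, hk using Nat.le_induction with
    | base => exact hn
    | succ k hk ih =>
      refine lt_of_le_of_lt ?_ ih
      have hma : m ≤ normk B k (ahat k) :=
        (hnear k (x k) (hnorm_lt k ih)).2 _ (hN k (hnN.trans hk)) _ (hahatmem k)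
      have hσ : C * σ k ≤ C / (δ * m) * (f (x k) - f (x (k+1))) := by
        rw [div_mul_eq_mul_div, le_div_iff₀ (by positivity), mul_assoc]
        refine mul_le_mul_of_nonneg_left ?_ hC₀.le
        have := mul_le_mul_of_nonneg_left hma (mul_pos hδ₀ (hσpos k)).le
        linarith [hdesc k]
      have hmove : ‖x (k+1) - x k‖ ≤ C * σ k := by
        have hlow := hBlow k (ahat k)
        rw [one_div, inv_mul_le_iff₀ hC₀] at hlow
        rw [hxS, sub_sub_cancel_left, norm_neg, norm_smul, Real.norm_eq_abs,
          abs_of_pos (div_pos (hσpos k) (hahatpos k)), div_mul_eq_mul_div,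
          div_le_iff₀ (hahatpos k)]
        calc σ k * ‖ahat k‖ ≤ σ k * (C * normk B k (ahat k)) :=
              mul_le_mul_of_nonneg_left hlow (hσpos k).le
          _ = C * σ k * normk B k (ahat k) := by ring
      have htri := norm_sub_le_norm_sub_add_norm_sub (x (k+1)) (x k) z
      rw [mul_sub] at hσ ⊢
      rw [mul_sub]
      linarith
  have hclose : ∀ᶠ k in atTop, ‖x k - z‖ < r :=
    eventually_atTop.2 ⟨φ n, fun k hk => hnorm_lt k (hstay k hk)⟩
  have ham : ∀ᶠ k in atTop, m ≤ normk B k (a k) :=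
    hclose.mono fun k hk => (hnear k (x k) hk).1 _ (hak k)
  obtain ⟨ρ, hρ, hρT⟩ := (nhdsGT_basis (0:ℝ)).eventually_iff.1 (hT₁lim.eventually_lt_const hm)
  have hmin : 0 < min (ρ / 2) (r / 2) := by positivity
  have hG_le : ∀ᶠ k in atTop, G (normk B k (a k)) (εs k) ≤ εs (k+1) := by
    filter_upwards [hclose, ham, hεlim'.eventually_lt_const (hT₂pos _ hmin)] with k hk hak' hεk
    have hεkipos : ∀ i ≤ ik k, 0 < εki k i := by
      intro i
      induction i with
      | zero => exact fun _ => (hGpos _ _ (hm.trans_le hak') (hεspos k)).trans_le (hεki0 k)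
      | succ i ih =>
        intro hi
        rw [hεkiS k i hi]
        exact hT₂pos _ (ih (Nat.le_of_succ_le hi))
    rcases hik : ik k with _ | j
    · rw [hεsS, hik]
      exact hεki0 k
    · have hj : j < ik k := by omega
      have hjpos := hεkipos j hj.le
      obtain ⟨b, hb, hbT⟩ := hnull k j hj
      have hlarge : min (ρ / 2) (r / 2) ≤ εki k j := by
        by_contra! hlt
        obtain ⟨hltρ, hltr⟩ := lt_min_iff.1 hlt
        have hbm := (hnear k (x k) hk).2 _ (by linarith) b hb
        have hTm : T₁ (εki k j) < m := hρT ⟨hjpos, by linarith⟩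
        linarith
      rw [hεsS, hik, hεkiS k j hj] at hεk
      exact absurd (hT₂mono hmin hjpos hlarge) hεk.not_ge
  rcases hG with hG | hG
  · obtain ⟨K, hK⟩ := eventually_atTop.1 (ham.and hG_le)
    have hapos : ∀ k, 0 < normk B (k + K) (a (k + K)) := fun k =>
      hm.trans_le (hK (k + K) (Nat.le_add_left K k)).1
    have hlim := hG (fun k => normk B (k + K) (a (k + K))) (fun k => εs (k + K)) hapos
      (fun k => hεspos _)
      (squeeze_zero (fun k => (hGpos _ _ (hapos k) (hεspos _)).le)
        (fun k => (hK (k + K) (Nat.le_add_left K k)).2)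
        (hεlim'.comp (tendsto_add_atTop_nat K)))
    exact hm.not_ge (ge_of_tendsto' hlim fun k => (hK (k + K) (Nat.le_add_left K k)).1)
  · obtain ⟨t₀, ht₀, hGt⟩ := hG (m / 2) (by positivity)
    have hinc : ∀ᶠ k in atTop, εs k ≤ εs (k+1) := by
      filter_upwards [ham, hG_le, hεlim.eventually_lt_const ht₀] with k hak' hGk hεk
      exact (hGt _ _ (by linarith) (hεspos k) hεk).trans hGk
    obtain ⟨K, hK⟩ := eventually_atTop.1 hinc
    have hge : ∀ k ≥ K, εs K ≤ εs k := fun k hk =>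
      Nat.le_induction le_rfl (fun j hj ih => ih.trans (hK j hj)) k hk
    exact (hεspos K).not_ge (ge_of_tendsto hεlim (eventually_atTop.2 ⟨K, hge⟩))
end
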